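/- Let (Ω, F, P) be a probability space, X : Ω → (ℝ_{≥0} → ℝⁿ) a trajectory-valued random variable, x : ℝ_{≥0} → ℝⁿ a deterministic trajectory, and (E_t)_{t≥0} a family of subsets of ℝⁿ. Let φ be a negation-free STL formula with set-membership atoms π_i := (x(t) ∈ C_i), and let φ̃ be obtained by replacing each atom with the time-varying tightened atom (x(t) ∈ C_i ⊖ E_t). Assume: (i) the event A := {ω ∈ Ω : X(ω)(t) − x(t) ∈ E_t for all t ≥ 0} is measurable with P(A) ≥ 1 − δ for some δ ∈ [0,1]; (ii) the event B := {ω ∈ Ω : (X(ω), 0) ⊨ φ} is measurable; (iii) (x, 0) ⊨ φ̃. Then P(B) ≥ 1 − δ, i.e., the stochastic trajectory satisfies φ at time 0 with probability at least 1 − δ. -/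

import Mathlib

open MeasureTheory

/-- Pontryagin difference: `A ⊖ B = {x | x + b ∈ A for all b ∈ B}`. -/
def pontryaginDiff {n : ℕ} (A B : Set (Fin n → ℝ)) : Set (Fin n → ℝ) :=
  {x | ∀ b ∈ B, x + b ∈ A}

/-- Negation-free STL formulas over a family of atomic predicates indexed by `I`. -/
inductive STL (I : Type*) where
  | atom : I → STL I
  | and : STL I → STL I → STL I
  | or : STL I → STL I → STL I
  | always : ℝ → ℝ → STL I → STL I
  | eventually : ℝ → ℝ → STL I → STL I
  | untl : ℝ → ℝ → STL I → STL I → STL I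

/-- Well-formedness: every temporal interval `[a,b]` satisfies `0 ≤ a ≤ b`. -/
def STL.WF {I : Type*} : STL I → Prop
  | .atom _ => True
  | .and φ ψ => φ.WF ∧ ψ.WF
  | .or φ ψ => φ.WF ∧ ψ.WF
  | .always a b φ => 0 ≤ a ∧ a ≤ b ∧ φ.WF
  | .eventually a b φ => 0 ≤ a ∧ a ≤ b ∧ φ.WF
  | .untl a b φ ψ => 0 ≤ a ∧ a ≤ b ∧ φ.WF ∧ ψ.WF

/-- Boolean satisfaction of an STL formula at time `t`, given an interpretation `v`
assigning to each atom a time-varying truth value. -/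
def STL.Sat {I : Type*} (v : I → ℝ → Prop) : STL I → ℝ → Prop
  | .atom i, t => v i t
  | .and φ ψ, t => φ.Sat v t ∧ ψ.Sat v t
  | .or φ ψ, t => φ.Sat v t ∨ ψ.Sat v t
  | .always a b φ, t => ∀ τ ∈ Set.Icc (t + a) (t + b), φ.Sat v τ
  | .eventually a b φ, t => ∃ τ ∈ Set.Icc (t + a) (t + b), φ.Sat v τ
  | .untl a b φ ψ, t =>
      ∃ τ ∈ Set.Icc (t + a) (t + b), ψ.Sat v τ ∧ ∀ τ' ∈ Set.Icc t τ, φ.Sat v τ'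

/-- Satisfaction is monotone in the interpretation of the atoms at nonnegative times. -/
theorem STL.Sat.mono {I : Type*} {v w : I → ℝ → Prop}
    (hvw : ∀ i t, 0 ≤ t → v i t → w i t) {φ : STL I} (hφ : φ.WF) {t : ℝ} (ht : 0 ≤ t)
    (h : φ.Sat v t) : φ.Sat w t := by
  induction φ generalizing t with
  | atom i => exact hvw i t ht h
  | and φ ψ ihφ ihψ => exact ⟨ihφ hφ.1 ht h.1, ihψ hφ.2 ht h.2⟩
  | or φ ψ ihφ ihψ => exact Or.imp (ihφ hφ.1 ht) (ihψ hφ.2 ht) h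
  | always a b φ ih =>
    exact fun τ hτ => ih hφ.2.2 ((add_nonneg ht hφ.1).trans hτ.1) (h τ hτ)
  | eventually a b φ ih =>
    obtain ⟨τ, hτ, hs⟩ := h
    exact ⟨τ, hτ, ih hφ.2.2 ((add_nonneg ht hφ.1).trans hτ.1) hs⟩
  | untl a b φ ψ ihφ ihψ =>
    obtain ⟨τ, hτ, hs, hall⟩ := h
    exact ⟨τ, hτ, ihψ hφ.2.2.2 ((add_nonneg ht hφ.1).trans hτ.1) hs,
      fun τ' hτ' => ihφ hφ.2.2.1 (ht.trans hτ'.1) (hall τ' hτ')⟩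

/-- STL formula erosion, probabilistic version: if the probabilistic reachable tube event
has probability at least `1 - δ` and the nominal trajectory satisfies the eroded formula
at time `0`, then the stochastic trajectory satisfies the original formula at time `0`
with probability at least `1 - δ`. -/
theorem STL.erosion_prob {m n : ℕ}
    {Ω : Type*} [MeasurableSpace Ω] (P : Measure Ω) [IsProbabilityMeasure P]
    (X : Ω → ℝ → (Fin n → ℝ)) (x : ℝ → (Fin n → ℝ))
    (E : ℝ → Set (Fin n → ℝ))
    (φ : STL (Fin m)) (hφ : φ.WF)
    (C : Fin m → Set (Fin n → ℝ))
    (δ : ℝ) (hδ : δ ∈ Set.Icc (0 : ℝ) 1)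
    (hA : MeasurableSet {ω : Ω | ∀ t : ℝ, 0 ≤ t → X ω t - x t ∈ E t})
    (hPA : (1 : ENNReal) - ENNReal.ofReal δ ≤
      P {ω : Ω | ∀ t : ℝ, 0 ≤ t → X ω t - x t ∈ E t})
    (hB : MeasurableSet {ω : Ω | φ.Sat (fun i s => X ω s ∈ C i) 0})
    (hnom : φ.Sat (fun i s => x s ∈ pontryaginDiff (C i) (E s)) 0) :
    (1 : ENNReal) - ENNReal.ofReal δ ≤
      P {ω : Ω | φ.Sat (fun i s => X ω s ∈ C i) 0} := by
  refine hPA.trans (measure_mono fun ω hω => hnom.mono (fun i t ht hx => ?_) hφ le_rfl)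
  simpa using hx _ (hω t ht)
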